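/- Rogers (symmetric Macdonald) polynomials via symmetrization: define P_0 := 1 and, for n ≥ 1, P_n := E_{−n} + (t(1 − qⁿ)/(1 − t qⁿ))·E_n. Then for every n ≥ 1, P_n = E_n + t^{1/2}·T(E_n), and for every n ≥ 0, P_n is symmetric: s(P_n) = P_n. -/

import Mathlib

/-!
Nonsymmetric Macdonald polynomials of type A₁: the explicit Laurent polynomials `E n`
are eigenfunctions of the Dunkl-type operator `Y` with eigenvalue `q^{-n_#}`.

The ground field is `F = ℚ(u,v)` with `q = u⁴`, `t = v²`; the Laurent polynomials
`F[X, X⁻¹]` are regarded inside the ambient field `M = F(X)`, in which all operators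
are given by the same formulas (division by `X² - 1` is then unproblematic).
-/

noncomputable section

/-- The ground field `ℚ(u,v)`. -/
abbrev F : Type := RatFunc (RatFunc ℚ)

/-- `u`, with `q = u⁴` (so `u = q^{1/4}`). -/
def u : F := RatFunc.C RatFunc.X

/-- `v`, with `t = v²` (so `v = t^{1/2}`). -/
def v : F := RatFunc.X

/-- `q = u⁴`. -/
def q : F := u ^ 4

/-- `t = v²`. -/
def t : F := v ^ 2

/-- The ambient field `F(X)` containing the Laurent polynomials `F[X,X⁻¹]`. -/
abbrev M : Type := RatFunc F

/-- The variable `X`. -/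
def XM : M := RatFunc.X

/-- The involution `s : Xⁿ ↦ X⁻ⁿ` (the substitution `X ↦ X⁻¹`). -/
def sOp : M → M := RatFunc.eval RatFunc.C (XM⁻¹)

/-- The operator `π : Xⁿ ↦ q^{n/2} X⁻ⁿ` (the substitution `X ↦ q^{1/2} X⁻¹`). -/
def piOp : M → M := RatFunc.eval RatFunc.C (RatFunc.C (u ^ 2) * XM⁻¹)

/-- The Demazure-Lusztig operator
`T(f) = t^{1/2}·s(f) + (t^{1/2} - t^{-1/2})·(s(f) - f)/(X² - 1)`. -/
def TOp (f : M) : M :=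
  RatFunc.C v * sOp f + RatFunc.C (v - v⁻¹) * (sOp f - f) / (XM ^ 2 - 1)

/-- The operator `Y = π ∘ T`. -/
def YOp (f : M) : M := piOp (TOp f)

/-- The product `∏_{i=0}^{j-1} [(1-q^{n-i-1})(1-t qⁱ)]/[(1-q^{1+i})(1-t q^{n-i-1})]`. -/
def macProdPos (n j : ℕ) : F :=
  ∏ i ∈ Finset.range j,
    ((1 - q ^ ((n : ℤ) - i - 1)) * (1 - t * q ^ (i : ℤ))) /
      ((1 - q ^ ((i : ℤ) + 1)) * (1 - t * q ^ ((n : ℤ) - i - 1)))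

/-- The product `∏_{i=0}^{j-1} [(1-q^{n-i})(1-t qⁱ)]/[(1-q^{1+i})(1-t q^{n-i})]`. -/
def macProdNeg (n j : ℕ) : F :=
  ∏ i ∈ Finset.range j,
    ((1 - q ^ ((n : ℤ) - i)) * (1 - t * q ^ (i : ℤ))) /
      ((1 - q ^ ((i : ℤ) + 1)) * (1 - t * q ^ ((n : ℤ) - i)))

/-- `E_n` for `n ≥ 1`. -/
def Epos (n : ℕ) : M :=
  XM ^ (n : ℤ)
    + ∑ j ∈ Finset.Icc 1 (n / 2),
        RatFunc.C (q ^ ((n : ℤ) - j) * (1 - q ^ (j : ℤ)) / (1 - q ^ ((n : ℤ) - j)) *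
          macProdPos n j) * XM ^ (2 * (j : ℤ) - n)
    + ∑ j ∈ Finset.Icc 1 ((n - 1) / 2),
        RatFunc.C (q ^ (j : ℤ) * macProdPos n j) * XM ^ ((n : ℤ) - 2 * j)

/-- `E_{-n}` for `n ≥ 1`. -/
def Eneg (n : ℕ) : M :=
  XM ^ (-(n : ℤ))
    + RatFunc.C ((1 - t) / (1 - t * q ^ (n : ℤ))) * XM ^ (n : ℤ)
    + ∑ j ∈ Finset.Icc 1 (n / 2),
        RatFunc.C (macProdNeg n j) * XM ^ (2 * (j : ℤ) - n)
    + ∑ j ∈ Finset.Icc 1 ((n - 1) / 2),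
        RatFunc.C ((1 - t * q ^ (j : ℤ)) / (1 - t * q ^ ((n : ℤ) - j)) * macProdNeg n j) *
          XM ^ ((n : ℤ) - 2 * j)

/-- The nonsymmetric Macdonald polynomials `E_n`, `n ∈ ℤ`, given by the explicit formulas. -/
def E : ℤ → M := fun n => if 0 < n then Epos n.toNat else if n = 0 then 1 else Eneg (-n).toNat

/-- The Rogers (symmetric Macdonald) polynomials:
`P_0 = 1` and `P_n = E_{-n} + (t(1-qⁿ)/(1-tqⁿ))·E_n` for `n ≥ 1`. -/
def P (n : ℕ) : M :=
  if n = 0 then 1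
  else E (-(n : ℤ)) + RatFunc.C (t * (1 - q ^ (n : ℤ)) / (1 - t * q ^ (n : ℤ))) * E (n : ℤ)

/-! ### The involution `s` is a ring homomorphism -/

lemma XM_ne : XM ≠ 0 := RatFunc.X_ne_zero

lemma eval_inv_ne (p : Polynomial F) (hp : p ≠ 0) :
    Polynomial.eval₂ (RatFunc.C : F →+* M) (XM⁻¹) p ≠ 0 := by
  have h1 : Transcendental F (XM) := RatFunc.transcendental_X
  have h2 : Transcendental F (XM⁻¹) := fun h => h1 (by
    have h3 := h.inv
    have h4 : (XM⁻¹)⁻¹ = XM := inv_inv (G := M) XM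
    exact h4 ▸ h3)
  intro h
  apply h2
  refine ⟨p, hp, ?_⟩
  rw [Polynomial.aeval_def, RatFunc.algebraMap_eq_C]
  exact h

/-- `s` as a ring homomorphism. -/
def sHom : M →+* M where
  toFun := sOp
  map_one' := RatFunc.eval_one _ _
  map_zero' := RatFunc.eval_zero _ _
  map_add' x y := RatFunc.eval_add _ _ (eval_inv_ne _ (RatFunc.denom_ne_zero x))
    (eval_inv_ne _ (RatFunc.denom_ne_zero y))
  map_mul' x y := RatFunc.eval_mul _ _ (eval_inv_ne _ (RatFunc.denom_ne_zero x))
    (eval_inv_ne _ (RatFunc.denom_ne_zero y))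

lemma sOp_eq (x : M) : sOp x = sHom x := rfl

lemma sHom_C (c : F) : sHom (RatFunc.C c) = RatFunc.C c := RatFunc.eval_C _ _

lemma sHom_X : sHom XM = XM⁻¹ := RatFunc.eval_X _ _

lemma sHom_zpow (k : ℤ) : sHom (XM ^ k) = XM ^ (-k) := by
  have h1 : sHom (XM ^ k) = (sHom XM) ^ k := map_zpow₀ (sHom : M →+* M) XM k
  have h2 : (XM⁻¹) ^ k = XM ^ (-k) := inv_zpow' XM k
  rw [h1, sHom_X, h2]

lemma XM_zpow_two (k : ℤ) : XM ^ k * XM ^ 2 = XM ^ (k + 2) := by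
  have h1 : XM ^ (k + 2) = XM ^ k * XM ^ (2 : ℤ) := zpow_add₀ (G₀ := M) XM_ne k 2
  have h2 : XM ^ (2 : ℤ) = XM ^ 2 := zpow_natCast XM 2
  rw [h1, h2]

lemma XM_sq_ne : XM ^ 2 - 1 ≠ 0 := by
  intro h
  have h1 : Transcendental F (XM) := RatFunc.transcendental_X
  apply h1
  refine ⟨Polynomial.X ^ 2 - Polynomial.C 1, Polynomial.X_pow_sub_C_ne_zero (by norm_num) 1, ?_⟩
  simpa using h

/-! ### Nonvanishing in the ground field -/

lemma one_sub_q_ne (k : ℕ) : 1 - q ^ (k + 1) ≠ 0 := by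
  intro h
  have h1 : (RatFunc.C ((RatFunc.X : RatFunc ℚ) ^ (4 * (k + 1))) : F) = RatFunc.C 1 := by
    rw [map_pow, map_one, pow_mul]
    exact (sub_eq_zero.mp h).symm
  have h2 := RatFunc.C_injective h1
  have h3 : algebraMap (Polynomial ℚ) (RatFunc ℚ) (Polynomial.X ^ (4 * (k + 1)))
      = algebraMap (Polynomial ℚ) (RatFunc ℚ) 1 := by
    simpa using h2
  have h4 := congrArg (Polynomial.eval 0) (RatFunc.algebraMap_injective ℚ h3)
  simp at h4

lemma one_sub_tq_ne (k : ℕ) : 1 - t * q ^ k ≠ 0 := by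
  intro h
  have h3 : algebraMap (Polynomial (RatFunc ℚ)) F
        (Polynomial.X ^ 2 * Polynomial.C (RatFunc.X ^ 4) ^ k)
      = algebraMap (Polynomial (RatFunc ℚ)) F 1 := by
    have := (sub_eq_zero.mp h).symm
    simpa [t, q, u, v] using this
  have h4 := congrArg (Polynomial.eval 0) (RatFunc.algebraMap_injective _ h3)
  simp at h4

/-! ### The coefficients -/

/-- `(q;q)_k`. -/
def qf (k : ℕ) : F := ∏ i ∈ Finset.range k, (1 - q ^ (i + 1))

/-- `(t;q)_k`. -/
def tf (k : ℕ) : F := ∏ i ∈ Finset.range k, (1 - t * q ^ i)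

lemma qf_ne (k : ℕ) : qf k ≠ 0 := Finset.prod_ne_zero_iff.mpr fun i _ => one_sub_q_ne i

lemma tf_ne (k : ℕ) : tf k ≠ 0 := Finset.prod_ne_zero_iff.mpr fun i _ => one_sub_tq_ne i

lemma qf_succ (k : ℕ) : qf (k + 1) = qf k * (1 - q ^ (k + 1)) := Finset.prod_range_succ _ _

lemma tf_succ (k : ℕ) : tf (k + 1) = tf k * (1 - t * q ^ k) := Finset.prod_range_succ _ _

/-- The coefficients of the Rogers polynomial. -/
def cf (k m : ℕ) : F := qf (k + m) / (qf k * qf m) * (tf k * tf m / tf (k + m))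

lemma cf_symm (k m : ℕ) : cf k m = cf m k := by
  unfold cf
  rw [add_comm, mul_comm (qf k), mul_comm (tf k)]

lemma cf_zero (m : ℕ) : cf 0 m = 1 := by
  have := qf_ne m
  have := tf_ne m
  unfold cf
  simp only [zero_add]
  rw [show qf 0 = 1 from rfl, show tf 0 = 1 from rfl]
  field_simp

lemma cf_rec (k m : ℕ) : cf (k + 1) m * ((1 - q ^ (k + 1)) * (1 - t * q ^ m)) =
    cf k (m + 1) * ((1 - q ^ (m + 1)) * (1 - t * q ^ k)) := by
  unfold cf
  rw [show k + (m + 1) = k + 1 + m by ring, qf_succ, qf_succ, tf_succ, tf_succ]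
  have := qf_ne k
  have := tf_ne k
  have := qf_ne m
  have := tf_ne m
  have := qf_ne (k + 1 + m)
  have := tf_ne (k + 1 + m)
  have := one_sub_q_ne k
  have := one_sub_q_ne m
  have := one_sub_tq_ne k
  have := one_sub_tq_ne m
  field_simp

lemma cf_succ (k m : ℕ) : cf (k + 1) m =
    cf k (m + 1) * ((1 - q ^ (m + 1)) * (1 - t * q ^ k)) /
      ((1 - q ^ (k + 1)) * (1 - t * q ^ m)) := by
  rw [eq_div_iff (mul_ne_zero (one_sub_q_ne k) (one_sub_tq_ne m)), cf_rec]

lemma macProdPos_eq (n k m : ℕ) (hn : 1 ≤ n) (h : k + m = n) :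
    macProdPos n k = cf k m * (1 - q ^ m) / (1 - q ^ n) := by
  obtain ⟨n', rfl⟩ : ∃ n', n = n' + 1 := ⟨n - 1, by omega⟩
  have hq := one_sub_q_ne n'
  induction k generalizing m with
  | zero =>
    obtain rfl : m = n' + 1 := by omega
    rw [cf_zero, one_mul, div_self hq]
    rfl
  | succ k ih =>
    have e1 : ((n' + 1 : ℕ) : ℤ) - (k : ℤ) - 1 = (m : ℕ) := by omega
    have e2 : (k : ℤ) + 1 = ((k + 1 : ℕ) : ℤ) := by push_cast; rfl
    have step : macProdPos (n' + 1) (k + 1) = macProdPos (n' + 1) k *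
        (((1 - q ^ m) * (1 - t * q ^ k)) / ((1 - q ^ (k + 1)) * (1 - t * q ^ m))) := by
      unfold macProdPos
      rw [Finset.prod_range_succ, e1, e2]
      simp only [zpow_natCast]
    rw [step, ih (m + 1) (by omega), cf_succ]
    have := one_sub_q_ne k
    have := one_sub_tq_ne m
    field_simp

lemma macProdNeg_eq (n k m : ℕ) (h : k + m = n) :
    macProdNeg n k = cf k m * (1 - t * q ^ m) / (1 - t * q ^ n) := by
  have hq := one_sub_tq_ne n
  induction k generalizing m with
  | zero =>
    obtain rfl : m = n := by omega
    rw [cf_zero, one_mul, div_self hq]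
    rfl
  | succ k ih =>
    have e1 : (n : ℤ) - (k : ℤ) = ((m + 1 : ℕ) : ℤ) := by omega
    have e2 : (k : ℤ) + 1 = ((k + 1 : ℕ) : ℤ) := by push_cast; rfl
    have step : macProdNeg n (k + 1) = macProdNeg n k *
        (((1 - q ^ (m + 1)) * (1 - t * q ^ k)) /
          ((1 - q ^ (k + 1)) * (1 - t * q ^ (m + 1)))) := by
      unfold macProdNeg
      rw [Finset.prod_range_succ, e1, e2]
      simp only [zpow_natCast]
    rw [step, ih (m + 1) (by omega), cf_succ]
    have := one_sub_q_ne k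
    have := one_sub_tq_ne m
    have := one_sub_tq_ne (m + 1)
    field_simp

/-! ### Reindexing -/

lemma sum_split (n : ℕ) (hn : 1 ≤ n) (g : ℕ → M) :
    ∑ k ∈ Finset.range (n + 1), g k =
      g 0 + g n + ∑ j ∈ Finset.Icc 1 (n / 2), g (n - j)
        + ∑ j ∈ Finset.Icc 1 ((n - 1) / 2), g j := by
  have hI : ∀ (m : ℕ) (f : ℕ → M), f 0 + ∑ j ∈ Finset.Icc 1 m, f j =
      ∑ j ∈ Finset.range (m + 1), f j := by
    intro m f
    induction m with
    | zero => simp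
    | succ m ih =>
      rw [Finset.sum_range_succ, ← ih, Finset.sum_Icc_succ_top (by omega), add_assoc]
  have h1 := hI ((n - 1) / 2) g
  have h2 := hI (n / 2) (fun j => g (n - j))
  have h3 : n + 1 = ((n - 1) / 2 + 1) + (n / 2 + 1) := by omega
  rw [h3, Finset.sum_range_add, ← h1, ← Finset.sum_range_reflect]
  have h4 : ∑ j ∈ Finset.range (n / 2 + 1), g ((n - 1) / 2 + 1 + (n / 2 + 1 - 1 - j)) =
      ∑ j ∈ Finset.range (n / 2 + 1), g (n - j) := by
    refine Finset.sum_congr rfl fun j hj => ?_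
    rw [Finset.mem_range] at hj
    congr 1
    omega
  rw [h4, ← h2]
  simp only [Nat.sub_zero]
  ring

/-- Coefficient of `X^{n-2k}` in `E_n`. -/
def ef (n k : ℕ) : F := q ^ k * (cf k (n - k) * (1 - q ^ (n - k)) / (1 - q ^ n))

lemma Epos_eq (n : ℕ) (hn : 1 ≤ n) :
    Epos n = ∑ k ∈ Finset.range (n + 1), RatFunc.C (ef n k) * XM ^ ((n : ℤ) - 2 * k) := by
  have hqn : 1 - q ^ n ≠ 0 := by
    obtain ⟨n', rfl⟩ : ∃ n', n = n' + 1 := ⟨n - 1, by omega⟩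
    exact one_sub_q_ne n'
  rw [sum_split n hn]
  have h0 : ef n 0 = 1 := by
    unfold ef
    rw [cf_zero]
    simp [div_self hqn]
  have hnn : ef n n = 0 := by
    unfold ef
    simp
  have hs1 : ∑ j ∈ Finset.Icc 1 (n / 2),
        RatFunc.C (q ^ ((n : ℤ) - j) * (1 - q ^ (j : ℤ)) / (1 - q ^ ((n : ℤ) - j)) *
          macProdPos n j) * XM ^ (2 * (j : ℤ) - n) =
      ∑ j ∈ Finset.Icc 1 (n / 2), RatFunc.C (ef n (n - j)) * XM ^ ((n : ℤ) - 2 * (n - j : ℕ)) := by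
    refine Finset.sum_congr rfl fun j hj => ?_
    rw [Finset.mem_Icc] at hj
    obtain ⟨m, rfl⟩ : ∃ m, n = j + (m + 1) := ⟨n - j - 1, by omega⟩
    have e1 : ((j + (m + 1) : ℕ) : ℤ) - j = ((m + 1 : ℕ) : ℤ) := by push_cast; ring
    have e2 : j + (m + 1) - j = m + 1 := by omega
    have e3 : j + (m + 1) - (m + 1) = j := by omega
    rw [e1, e2, macProdPos_eq (j + (m + 1)) j (m + 1) hn rfl]
    congr 2
    · unfold ef
      rw [e3, cf_symm (m + 1) j]
      simp only [zpow_natCast]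
      have := one_sub_q_ne m
      field_simp
    · push_cast
      ring
  have hs2 : ∑ j ∈ Finset.Icc 1 ((n - 1) / 2),
        RatFunc.C (q ^ (j : ℤ) * macProdPos n j) * XM ^ ((n : ℤ) - 2 * j) =
      ∑ j ∈ Finset.Icc 1 ((n - 1) / 2), RatFunc.C (ef n j) * XM ^ ((n : ℤ) - 2 * j) := by
    refine Finset.sum_congr rfl fun j hj => ?_
    rw [Finset.mem_Icc] at hj
    rw [macProdPos_eq n j (n - j) hn (by omega)]
    simp only [zpow_natCast, ef]
  unfold Epos
  rw [hs1, hs2, h0, hnn]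
  simp

/-- Coefficient of `X^{n-2k}` in `E_{-n}`. -/
def gf (n k : ℕ) : F := cf k (n - k) * (1 - t * q ^ k) / (1 - t * q ^ n)

lemma Eneg_eq (n : ℕ) (hn : 1 ≤ n) :
    Eneg n = ∑ k ∈ Finset.range (n + 1), RatFunc.C (gf n k) * XM ^ ((n : ℤ) - 2 * k) := by
  have hqn := one_sub_tq_ne n
  rw [sum_split n hn]
  have h0 : gf n 0 = (1 - t) / (1 - t * q ^ n) := by
    unfold gf
    rw [cf_zero]
    simp
  have hnn : gf n n = 1 := by
    unfold gf
    rw [cf_symm, Nat.sub_self, cf_zero, one_mul, div_self hqn]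
  have hs1 : ∑ j ∈ Finset.Icc 1 (n / 2),
        RatFunc.C (macProdNeg n j) * XM ^ (2 * (j : ℤ) - n) =
      ∑ j ∈ Finset.Icc 1 (n / 2), RatFunc.C (gf n (n - j)) * XM ^ ((n : ℤ) - 2 * (n - j : ℕ)) := by
    refine Finset.sum_congr rfl fun j hj => ?_
    rw [Finset.mem_Icc] at hj
    have e3 : n - (n - j) = j := by omega
    rw [macProdNeg_eq n j (n - j) (by omega)]
    congr 2
    · unfold gf
      rw [e3, cf_symm]
    · omega
  have hs2 : ∑ j ∈ Finset.Icc 1 ((n - 1) / 2),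
        RatFunc.C ((1 - t * q ^ (j : ℤ)) / (1 - t * q ^ ((n : ℤ) - j)) * macProdNeg n j) *
          XM ^ ((n : ℤ) - 2 * j) =
      ∑ j ∈ Finset.Icc 1 ((n - 1) / 2), RatFunc.C (gf n j) * XM ^ ((n : ℤ) - 2 * j) := by
    refine Finset.sum_congr rfl fun j hj => ?_
    rw [Finset.mem_Icc] at hj
    have e1 : (n : ℤ) - j = ((n - j : ℕ) : ℤ) := by omega
    rw [macProdNeg_eq n j (n - j) (by omega), e1]
    congr 2
    unfold gf
    simp only [zpow_natCast]
    have := one_sub_tq_ne (n - j)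
    field_simp
  unfold Eneg
  rw [hs1, hs2, h0, hnn]
  simp only [zpow_natCast, map_one, one_mul, Nat.cast_zero, mul_zero, sub_zero]
  rw [show (n : ℤ) - 2 * n = -n by ring]
  ring

lemma E_pos (n : ℕ) (hn : 1 ≤ n) : E (n : ℤ) = Epos n := by
  unfold E
  rw [if_pos (by omega)]
  simp

lemma E_neg (n : ℕ) (hn : 1 ≤ n) : E (-(n : ℤ)) = Eneg n := by
  unfold E
  rw [if_neg (by omega), if_neg (by omega)]
  simp

lemma P_eq (n : ℕ) (hn : 1 ≤ n) :
    P n = ∑ k ∈ Finset.range (n + 1), RatFunc.C (cf k (n - k)) * XM ^ ((n : ℤ) - 2 * k) := by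
  have hqn : 1 - q ^ n ≠ 0 := by
    obtain ⟨n', rfl⟩ : ∃ n', n = n' + 1 := ⟨n - 1, by omega⟩
    exact one_sub_q_ne n'
  have htn := one_sub_tq_ne n
  unfold P
  rw [if_neg (by omega), E_pos n hn, E_neg n hn, Epos_eq n hn, Eneg_eq n hn, Finset.mul_sum,
    ← Finset.sum_add_distrib]
  refine Finset.sum_congr rfl fun k hk => ?_
  rw [Finset.mem_range] at hk
  rw [← mul_assoc, ← map_mul, ← add_mul, ← map_add]
  congr 2
  obtain ⟨m, rfl⟩ : ∃ m, n = k + m := ⟨n - k, by omega⟩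
  have e : k + m - k = m := by omega
  unfold ef gf
  rw [e]
  simp only [zpow_natCast]
  field_simp
  ring

lemma sE_eq (n : ℕ) (hn : 1 ≤ n) :
    sOp (E n) = ∑ k ∈ Finset.range (n + 1),
      RatFunc.C (ef n (n - k)) * XM ^ ((n : ℤ) - 2 * k) := by
  rw [E_pos n hn, Epos_eq n hn, sOp_eq, map_sum, ← Finset.sum_range_reflect]
  refine Finset.sum_congr rfl fun k hk => ?_
  rw [Finset.mem_range] at hk
  rw [map_mul, sHom_C, sHom_zpow, show n + 1 - 1 - k = n - k by omega]
  congr 2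
  omega

lemma coeff_rec (k m : ℕ) :
    cf (k + 1) m - ef (k + 1 + m) (k + 1) - t * ef (k + 1 + m) m =
      cf k (m + 1) - t * ef (k + 1 + m) k - ef (k + 1 + m) (m + 1) := by
  have hqn : 1 - q ^ (k + 1 + m) ≠ 0 := by
    rw [show k + 1 + m = k + m + 1 by ring]
    exact one_sub_q_ne _
  have h := cf_rec k m
  unfold ef
  rw [show k + 1 + m - (k + 1) = m by omega, show k + 1 + m - m = k + 1 by omega,
    show k + 1 + m - k = m + 1 by omega, show k + 1 + m - (m + 1) = k by omega,
    cf_symm m, cf_symm (m + 1)]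
  field_simp
  linear_combination h

lemma key (n : ℕ) (hn : 1 ≤ n) :
    P n * (XM ^ 2 - 1) = (XM ^ 2 - RatFunc.C t) * E n + (RatFunc.C t * XM ^ 2 - 1) * sOp (E n) := by
  have hqn : 1 - q ^ n ≠ 0 := by
    obtain ⟨n', rfl⟩ : ∃ n', n = n' + 1 := ⟨n - 1, by omega⟩
    exact one_sub_q_ne n'
  have h0 : ef n 0 = 1 := by
    unfold ef
    rw [cf_zero]
    simp [div_self hqn]
  have hnn : ef n n = 0 := by
    unfold ef
    simp
  have main : ∑ k ∈ Finset.range (n + 1),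
        RatFunc.C (cf k (n - k) - ef n k - t * ef n (n - k)) * XM ^ ((n : ℤ) - 2 * k) * XM ^ 2 =
      ∑ k ∈ Finset.range (n + 1),
        RatFunc.C (cf k (n - k) - t * ef n k - ef n (n - k)) * XM ^ ((n : ℤ) - 2 * k) := by
    rw [Finset.sum_range_succ', Finset.sum_range_succ]
    have z1 : cf 0 (n - 0) - ef n 0 - t * ef n (n - 0) = 0 := by
      rw [cf_zero, h0, Nat.sub_zero, hnn]
      ring
    have z2 : cf n (n - n) - t * ef n n - ef n (n - n) = 0 := by
      rw [Nat.sub_self, cf_symm, cf_zero, h0, hnn]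
      ring
    rw [z1, z2]
    simp only [map_zero, zero_mul, add_zero]
    refine Finset.sum_congr rfl fun k hk => ?_
    rw [Finset.mem_range] at hk
    obtain ⟨m, rfl⟩ : ∃ m, n = k + 1 + m := ⟨n - k - 1, by omega⟩
    rw [show k + 1 + m - (k + 1) = m by omega, show k + 1 + m - k = m + 1 by omega,
      coeff_rec, mul_assoc, XM_zpow_two]
    congr 2
    push_cast
    ring
  rw [sE_eq n hn, E_pos n hn, Epos_eq n hn, P_eq n hn]
  simp only [map_sub, map_mul, sub_mul, Finset.sum_sub_distrib, mul_assoc, ← Finset.mul_sum] at main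
  simp only [← mul_assoc, ← Finset.sum_mul] at main
  linear_combination main

/-- Rogers polynomials via symmetrization: for every `n ≥ 1`,
`P_n = E_n + t^{1/2}·T(E_n)`, and for every `n ≥ 0`, `P_n` is symmetric: `s(P_n) = P_n`. -/
theorem rogers_symmetrization :
    (∀ n : ℕ, 1 ≤ n → P n = E (n : ℤ) + RatFunc.C v * TOp (E (n : ℤ))) ∧
    (∀ n : ℕ, sOp (P n) = P n) := by
  have hv : v ≠ 0 := RatFunc.X_ne_zero
  have h2 := XM_sq_ne
  refine ⟨fun n hn => ?_, fun n => ?_⟩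
  · have hk := key n hn
    have hT : RatFunc.C v * TOp (E (n : ℤ)) = RatFunc.C t * sOp (E (n : ℤ)) +
        (RatFunc.C t - 1) * (sOp (E (n : ℤ)) - E (n : ℤ)) / (XM ^ 2 - 1) := by
      have a1 : (RatFunc.C t : M) = RatFunc.C v * RatFunc.C v := by
        rw [← map_mul, t, sq]
      have a2 : (RatFunc.C t - 1 : M) = RatFunc.C v * RatFunc.C (v - v⁻¹) := by
        rw [← map_mul, mul_sub, mul_inv_cancel₀ hv, t, sq, map_sub, map_one]
      rw [a2, a1, TOp]
      ring
    rw [hT]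
    field_simp
    linear_combination hk
  · rcases Nat.eq_zero_or_pos n with rfl | hn
    · rw [sOp_eq, P, if_pos rfl, map_one]
    · rw [P_eq n hn, sOp_eq, map_sum, ← Finset.sum_range_reflect]
      refine Finset.sum_congr rfl fun k hk => ?_
      rw [Finset.mem_range] at hk
      rw [map_mul, sHom_C, sHom_zpow, show n + 1 - 1 - k = n - k by omega,
        show n - (n - k) = k by omega, cf_symm]
      congr 2
      omega
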